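/- arXiv:1902.00945 — 4 statements merged into one kernel-verified Lean document; each statement's English description precedes it below -/
import Mathlib

section
/- For all integers i, j ≥ 0 with j − i ∉ {0, 2, −2}, the M-type polynomials M_i and M_j are orthogonal on [−1,1]: ∫_{−1}^{1} M_i(t) M_j(t) dt = 0. -/
open intervalIntegral

/-- The Legendre polynomial `l_j(t) = (1/(2^j j!)) (d/dt)^j (t²−1)^j`. -/
noncomputable def legendreP (j : ℕ) (t : ℝ) : ℝ :=
  (1 / (2 ^ j * (Nat.factorial j : ℝ))) * iteratedDeriv j (fun x : ℝ => (x ^ 2 - 1) ^ j) t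

/-- The M-type polynomials: `M_0(t) = 1`, `M_1(t) = t`, and
    `M_{k+1}(t) = (1/(2^k k!)) (d/dt)^{k−1} (t²−1)^k` for `k ≥ 1`. -/
noncomputable def Mpoly : ℕ → ℝ → ℝ
  | 0, _ => 1
  | 1, t => t
  | (k + 2), t =>
      (1 / (2 ^ (k + 1) * (Nat.factorial (k + 1) : ℝ))) *
        iteratedDeriv k (fun x : ℝ => (x ^ 2 - 1) ^ (k + 1)) t

open Polynomial in
theorem Polynomial.iteratedDeriv_eval (p : ℝ[X]) (n : ℕ) :
    iteratedDeriv n (fun x => p.eval x) = fun x => (derivative^[n] p).eval x := by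
  induction n with
  | zero => simp
  | succ n ih =>
    ext x
    rw [iteratedDeriv_succ, ih, Polynomial.deriv, Function.iterate_succ_apply']

open Polynomial in
/-- Repeated integration by parts: a polynomial killed by `m` derivatives is orthogonal to an
`m`-th derivative whose boundary terms all vanish. -/
theorem Polynomial.integral_mul_iterate_derivative_eq_zero {a b : ℝ} (q : ℝ[X]) (m : ℕ)
    (ha : ∀ k < m, (derivative^[k] q).eval a = 0) (hb : ∀ k < m, (derivative^[k] q).eval b = 0)
    (p : ℝ[X]) (hp : derivative^[m] p = 0) :
    ∫ t in a..b, p.eval t * (derivative^[m] q).eval t = 0 := by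
  induction m generalizing p with
  | zero => simp_all
  | succ m ih =>
    have hparts := integral_mul_deriv_eq_deriv_mul (a := a) (b := b)
      (fun x _ => p.hasDerivAt x) (fun x _ => (derivative^[m] q).hasDerivAt x)
      (p.derivative.continuous.intervalIntegrable _ _)
      ((derivative^[m] q).derivative.continuous.intervalIntegrable _ _)
    rw [Function.iterate_succ_apply', hparts, ha m m.lt_succ_self, hb m m.lt_succ_self,
      ih (fun k hk => ha k (hk.trans m.lt_succ_self)) (fun k hk => hb k (hk.trans m.lt_succ_self))
        _ (by rwa [Function.iterate_succ_apply] at hp)]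
    simp

open Polynomial in
theorem eval_iterate_derivative_sq_sub_one_pow {k n : ℕ} (h : k < n) {x : ℝ} (hx : x ^ 2 = 1) :
    (derivative^[k] ((X ^ 2 - 1 : ℝ[X]) ^ n)).eval x = 0 := by
  refine eval_eq_zero_of_dvd_of_eval_eq_zero
    ((dvd_pow_self _ (Nat.sub_ne_zero_of_lt h)).trans
      (pow_sub_dvd_iterate_derivative_pow (X ^ 2 - 1 : ℝ[X]) n k)) ?_
  simp [hx]

open Polynomial in
theorem Mpoly_add_two (k : ℕ) (t : ℝ) :
    Mpoly (k + 2) t = (1 / (2 ^ (k + 1) * (Nat.factorial (k + 1) : ℝ))) *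
      (derivative^[k] ((X ^ 2 - 1 : ℝ[X]) ^ (k + 1))).eval t := by
  have h := congrFun (Polynomial.iteratedDeriv_eval ((X ^ 2 - 1 : ℝ[X]) ^ (k + 1)) k) t
  simp only [eval_pow, eval_sub, eval_X, eval_one] at h
  rw [Mpoly, h]

open Polynomial in
theorem Mpoly_exists_polynomial (n : ℕ) :
    ∃ p : ℝ[X], p.natDegree ≤ n ∧ ∀ t, Mpoly n t = p.eval t := by
  match n with
  | 0 => exact ⟨1, by simp, fun t => by simp [Mpoly]⟩
  | 1 => exact ⟨X, by simp, fun t => by simp [Mpoly]⟩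
  | k + 2 =>
    refine ⟨C (1 / (2 ^ (k + 1) * (Nat.factorial (k + 1) : ℝ))) *
      derivative^[k] ((X ^ 2 - 1 : ℝ[X]) ^ (k + 1)), ?_, fun t => by
        rw [Mpoly_add_two, eval_mul, eval_C]⟩
    refine (natDegree_C_mul_le _ _).trans ((natDegree_iterate_derivative _ k).trans ?_)
    have h : ((X ^ 2 - 1 : ℝ[X]) ^ (k + 1)).natDegree ≤ (k + 1) * 2 :=
      natDegree_pow_le_of_le _ (by compute_degree)
    omega

theorem Mpoly_neg (n : ℕ) (t : ℝ) : Mpoly n (-t) = (-1) ^ n * Mpoly n t := by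
  match n with
  | 0 => simp [Mpoly]
  | 1 => simp [Mpoly]
  | k + 2 =>
    have h := iteratedDeriv_comp_neg k (fun x : ℝ => (x ^ 2 - 1) ^ (k + 1)) (-t)
    simp only [neg_sq, neg_neg, smul_eq_mul] at h
    simp only [Mpoly, h]
    ring

theorem integral_Mpoly_mul_Mpoly_of_odd_add {i j : ℕ} (h : Odd (i + j)) :
    ∫ t in (-1:ℝ)..1, Mpoly i t * Mpoly j t = 0 := by
  have hneg := integral_comp_neg (a := -1) (b := 1) (fun t : ℝ => Mpoly i t * Mpoly j t)
  have hodd (t : ℝ) : Mpoly i (-t) * Mpoly j (-t) = -(Mpoly i t * Mpoly j t) := by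
    rw [Mpoly_neg, Mpoly_neg, mul_mul_mul_comm, ← pow_add, h.neg_one_pow, neg_one_mul]
  simp only [hodd, neg_neg, integral_neg] at hneg
  linarith

theorem integral_Mpoly_mul_Mpoly_of_add_two_lt {i j : ℕ} (h : i + 2 < j) :
    ∫ t in (-1:ℝ)..1, Mpoly i t * Mpoly j t = 0 := by
  obtain ⟨k, rfl⟩ := Nat.exists_eq_add_of_le' (show 2 ≤ j by omega)
  obtain ⟨p, hdeg, hp⟩ := Mpoly_exists_polynomial i
  simp only [hp, Mpoly_add_two, mul_left_comm (p.eval _), integral_const_mul]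
  rw [Polynomial.integral_mul_iterate_derivative_eq_zero _ _ _ _ p
    (Polynomial.iterate_derivative_eq_zero (by omega)), mul_zero]
  all_goals
    exact fun m hm => eval_iterate_derivative_sq_sub_one_pow (by omega) (by norm_num)

/-- For all integers `i, j ≥ 0` with `j − i ∉ {0, 2, −2}`,
`∫_{−1}^{1} M_i(t) M_j(t) dt = 0`. -/
theorem Mpoly_orthogonal (i j : ℕ) (h0 : (j : ℤ) - (i : ℤ) ≠ 0)
    (h2 : (j : ℤ) - (i : ℤ) ≠ 2) (hm2 : (j : ℤ) - (i : ℤ) ≠ -2) :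
    ∫ t in (-1:ℝ)..1, Mpoly i t * Mpoly j t = 0 := by
  wlog hij : i ≤ j generalizing i j
  · simpa only [mul_comm] using this j i (by omega) (by omega) (by omega) (by omega)
  by_cases hj : j = i + 1
  · exact integral_Mpoly_mul_Mpoly_of_odd_add ⟨i, by omega⟩
  · exact integral_Mpoly_mul_Mpoly_of_add_two_lt (by omega)
end

section
/- For every integer k ≥ 2 and every integer m with 0 ≤ m ≤ k−2, the M-type polynomial M_{k+1} is orthogonal on [−1,1] to the monomial t^m: ∫_{−1}^{1} M_{k+1}(t) t^m dt = 0. Consequently M_{k+1} is orthogonal on [−1,1] to every polynomial of degree at most k−2. -/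
open intervalIntegral

open Polynomial in
theorem iteratedDeriv_eval_polynomial (q : ℝ[X]) (n : ℕ) :
    iteratedDeriv n (fun x => q.eval x) = fun x => (derivative^[n] q).eval x := by
  induction n with
  | zero => simp
  | succ n ih =>
    rw [iteratedDeriv_succ, ih, Function.iterate_succ_apply']
    ext x
    exact Polynomial.deriv _

open Polynomial in
/-- Repeated integration by parts: if the first `n` derivatives of `q`, starting from `q` itself,
vanish at both endpoints, then the `n`-th one is orthogonal to polynomials of degree below `n`. -/
theorem integral_iterate_derivative_mul_eval_eq_zero {a b : ℝ} (q : ℝ[X]) (n : ℕ)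
    (ha : ∀ i < n, (derivative^[i] q).eval a = 0) (hb : ∀ i < n, (derivative^[i] q).eval b = 0)
    (p : ℝ[X]) (hp : p.degree < n) :
    ∫ t in a..b, (derivative^[n] q).eval t * p.eval t = 0 := by
  induction n generalizing p with
  | zero =>
    obtain rfl : p = 0 := by simpa using hp
    simp
  | succ n ih =>
    have hderiv : (derivative p).degree < n := by
      rw [degree_lt_iff_coeff_zero] at hp ⊢
      intro m hm
      rw [coeff_derivative, hp (m + 1) (by omega), zero_mul]
    have hcont (r : ℝ[X]) : IntervalIntegrable (fun x => r.eval x) MeasureTheory.volume a b :=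
      r.continuous.intervalIntegrable a b
    simp only [Function.iterate_succ_apply', mul_comm _ (p.eval _)]
    rw [integral_mul_deriv_eq_deriv_mul (fun x _ => p.hasDerivAt x)
      (fun x _ => (derivative^[n] q).hasDerivAt x) (hcont _) (hcont _),
      ha n n.lt_succ_self, hb n n.lt_succ_self]
    simpa [mul_comm] using
      ih (fun i hi => ha i (hi.trans n.lt_succ_self)) (fun i hi => hb i (hi.trans n.lt_succ_self))
        (derivative p) hderiv

/-- For every integer `k ≥ 2` and every `0 ≤ m ≤ k−2`,
`∫_{−1}^{1} M_{k+1}(t) t^m dt = 0`; consequently `M_{k+1}` is orthogonal on `[−1,1]`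
to every polynomial of degree at most `k−2`. -/
theorem Mpoly_orthogonal_lower_monomials (k : ℕ) (hk : 2 ≤ k) :
    (∀ m : ℕ, m ≤ k - 2 → ∫ t in (-1:ℝ)..1, Mpoly (k + 1) t * t ^ m = 0) ∧
    (∀ p : Polynomial ℝ, p.degree ≤ ((k - 2 : ℕ) : WithBot ℕ) →
      ∫ t in (-1:ℝ)..1, Mpoly (k + 1) t * p.eval t = 0) := by
  obtain ⟨j, rfl⟩ := Nat.exists_eq_add_of_le' hk
  rw [Nat.add_sub_cancel]
  have main (p : Polynomial ℝ) (hp : p.degree ≤ (j : WithBot ℕ)) :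
      ∫ t in (-1:ℝ)..1, Mpoly (j + 2 + 1) t * p.eval t = 0 := by
    set q : Polynomial ℝ := (Polynomial.X ^ 2 - 1) ^ (j + 2) with hq
    have hvanish (x : ℝ) (hx : x ^ 2 = 1) (i : ℕ) (hi : i < j + 1) :
        (Polynomial.derivative^[i] q).eval x = 0 := by
      refine Polynomial.eval_eq_zero_of_dvd_of_eval_eq_zero
        (Polynomial.pow_sub_dvd_iterate_derivative_pow _ (j + 2) i) ?_
      simp [hx, show j + 2 - i ≠ 0 by omega]
    have hfun : (fun x : ℝ => (x ^ 2 - 1) ^ (j + 1 + 1)) = fun x => q.eval x := by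
      simp [hq]
    simp only [Mpoly, hfun, iteratedDeriv_eval_polynomial, mul_assoc,
      intervalIntegral.integral_const_mul]
    rw [integral_iterate_derivative_mul_eval_eq_zero q (j + 1) (hvanish _ (by norm_num))
      (hvanish _ (by norm_num)) p (hp.trans_lt (by exact_mod_cast j.lt_succ_self)), mul_zero]
  refine ⟨fun m hm => ?_, main⟩
  simpa using main (Polynomial.X ^ m) (by simpa using hm)
end

section
/- Let k ≥ 1 be an integer and let f be continuously differentiable on [−1,1]. Then the degree-k M-type projection f_k of f interpolates f at both endpoints: f_k(1) = f(1) and f_k(−1) = f(−1). -/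
open intervalIntegral

/-- The M-type coefficients of `f` (with derivative `f'` on `[-1,1]`):
    `b_0 = (f(1)+f(−1))/2`, `b_j = (j − 1/2) ∫_{−1}^{1} f'(t) l_{j−1}(t) dt` for `j ≥ 1`. -/
noncomputable def mcoeff (f f' : ℝ → ℝ) : ℕ → ℝ
  | 0 => (f 1 + f (-1)) / 2
  | (j + 1) => (((j : ℝ) + 1) - 1 / 2) * ∫ t in (-1:ℝ)..1, f' t * legendreP j t

/-- The degree-`k` M-type projection `f_k(t) = Σ_{j=0}^{k} b_j M_j(t)`. -/
noncomputable def mproj (f f' : ℝ → ℝ) (k : ℕ) (t : ℝ) : ℝ :=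
  ∑ j ∈ Finset.range (k + 1), mcoeff f f' j * Mpoly j t

/-- The iterated derivatives of a polynomial function are the evaluations of its iterated formal
derivatives. -/
theorem iteratedDeriv_polynomial_eval (p : Polynomial ℝ) (n : ℕ) :
    iteratedDeriv n (fun x => p.eval x) = fun x => (Polynomial.derivative^[n] p).eval x := by
  induction n with
  | zero => simp
  | succ n ih =>
    funext x
    rw [iteratedDeriv_succ, ih, Function.iterate_succ_apply', Polynomial.deriv]

/-- The zeros `±1` of `(x² - 1)^n` have order `n`. -/
theorem iteratedDeriv_sq_sub_one_pow_eq_zero {m n : ℕ} (hmn : m < n) {a : ℝ} (ha : a ^ 2 = 1) :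
    iteratedDeriv m (fun x : ℝ => (x ^ 2 - 1) ^ n) a = 0 := by
  have heval : (fun x : ℝ => (x ^ 2 - 1) ^ n) =
      fun x => ((Polynomial.X ^ 2 - 1 : Polynomial ℝ) ^ n).eval x := by
    funext x
    simp
  rw [heval, iteratedDeriv_polynomial_eval]
  obtain ⟨q, hq⟩ :=
    Polynomial.pow_sub_dvd_iterate_derivative_pow (Polynomial.X ^ 2 - 1 : Polynomial ℝ) n m
  simp [hq, ha, Nat.sub_ne_zero_of_lt hmn]

theorem Mpoly_add_two_eq_zero (k : ℕ) {a : ℝ} (ha : a ^ 2 = 1) : Mpoly (k + 2) a = 0 := by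
  simp [Mpoly, iteratedDeriv_sq_sub_one_pow_eq_zero (Nat.lt_succ_self k) ha]

/-- Only the two lowest modes contribute to a projection at the endpoints. -/
theorem mproj_eq_of_sq_eq_one {k : ℕ} (hk : 1 ≤ k) (f f' : ℝ → ℝ) {a : ℝ} (ha : a ^ 2 = 1) :
    mproj f f' k a = mcoeff f f' 0 + mcoeff f f' 1 * a := by
  obtain ⟨n, rfl⟩ := Nat.exists_eq_add_of_le' hk
  rw [mproj, Finset.sum_range_succ', Finset.sum_range_succ']
  simp only [add_assoc, Nat.reduceAdd, Mpoly_add_two_eq_zero _ ha, mul_zero, Finset.sum_const_zero]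
  simp [Mpoly, add_comm]

theorem mcoeff_one_eq {f f' : ℝ → ℝ}
    (hf : ∀ t ∈ Set.Icc (-1:ℝ) 1, HasDerivWithinAt f (f' t) (Set.Icc (-1:ℝ) 1) t)
    (hf' : ContinuousOn f' (Set.Icc (-1:ℝ) 1)) :
    mcoeff f f' 1 = (f 1 - f (-1)) / 2 := by
  have hint : ∫ t in (-1:ℝ)..1, f' t = f 1 - f (-1) :=
    integral_eq_sub_of_hasDerivAt_of_le (by norm_num)
      (fun t ht => (hf t ht).continuousWithinAt)
      (fun t ht => (hf t (Set.Ioo_subset_Icc_self ht)).hasDerivAt (Icc_mem_nhds ht.1 ht.2))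
      (hf'.intervalIntegrable_of_Icc (by norm_num))
  simp only [mcoeff, legendreP, iteratedDeriv_zero, pow_zero, Nat.factorial_zero, Nat.cast_one,
    Nat.cast_zero, mul_one, div_one, hint]
  ring

/-- Let `k ≥ 1` and let `f` be continuously differentiable on `[−1,1]`
(with derivative `f'`). Then the degree-`k` M-type projection `f_k` interpolates `f`
at both endpoints: `f_k(1) = f(1)` and `f_k(−1) = f(−1)`. -/
theorem mproj_interpolates_endpoints (k : ℕ) (hk : 1 ≤ k) (f f' : ℝ → ℝ)
    (hf : ∀ t ∈ Set.Icc (-1:ℝ) 1, HasDerivWithinAt f (f' t) (Set.Icc (-1:ℝ) 1) t)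
    (hf' : ContinuousOn f' (Set.Icc (-1:ℝ) 1)) :
    mproj f f' k 1 = f 1 ∧ mproj f f' k (-1) = f (-1) := by
  rw [mproj_eq_of_sq_eq_one hk f f' (one_pow 2), mproj_eq_of_sq_eq_one hk f f' (by norm_num),
    mcoeff_one_eq hf hf', mcoeff]
  constructor <;> ring
end

section
/- Let k ≥ 2 be an integer and let f be smooth (C^∞) on the square K̂ = [−1,1]². Then on each edge of K̂ the Q^k M-type projection remainder is orthogonal to all polynomials of degree at most k−2: for every polynomial v of one variable with deg v ≤ k−2 and each σ ∈ {−1,1}, ∫_{−1}^{1} (f(σ,t) − f_{k,k}(σ,t)) v(t) dt = 0 and ∫_{−1}^{1} (f(s,σ) − f_{k,k}(s,σ)) v(s) ds = 0. -/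
open intervalIntegral

/-- The 2D M-type coefficients `b_{i,j}` of a function `f` on `[−1,1]²`. -/
noncomputable def mcoeff2 (f : ℝ → ℝ → ℝ) : ℕ → ℕ → ℝ
  | 0, 0 => (f (-1) (-1) + f (-1) 1 + f 1 (-1) + f 1 1) / 4
  | 0, (j + 1) => ((2 * ((j : ℝ) + 1) - 1) / 4) *
      ∫ t in (-1:ℝ)..1, (deriv (f 1) t + deriv (f (-1)) t) * legendreP j t
  | (i + 1), 0 => ((2 * ((i : ℝ) + 1) - 1) / 4) *
      ∫ s in (-1:ℝ)..1,
        (deriv (fun x => f x 1) s + deriv (fun x => f x (-1)) s) * legendreP i s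
  | (i + 1), (j + 1) => ((2 * ((i : ℝ) + 1) - 1) * (2 * ((j : ℝ) + 1) - 1) / 4) *
      ∫ s in (-1:ℝ)..1, ∫ t in (-1:ℝ)..1,
        deriv (fun x => deriv (f x) t) s * legendreP i s * legendreP j t

/-- The `Q^k` M-type projection `f_{k,k}(s,t) = Σ_{i=0}^{k} Σ_{j=0}^{k} b_{i,j} M_i(s) M_j(t)`. -/
noncomputable def mproj2 (f : ℝ → ℝ → ℝ) (k : ℕ) (s t : ℝ) : ℝ :=
  ∑ i ∈ Finset.range (k + 1), ∑ j ∈ Finset.range (k + 1),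
    mcoeff2 f i j * Mpoly i s * Mpoly j t

open Polynomial in
/-- The Legendre polynomial, as an element of `ℝ[X]`, given by the Rodrigues formula. -/
noncomputable def legendrePoly (n : ℕ) : ℝ[X] :=
  C (1 / (2 ^ n * (Nat.factorial n : ℝ))) * derivative^[n] ((X ^ 2 - 1) ^ n)

/-- The one-dimensional M-type coefficients. -/
noncomputable def mcoeff1 (g : ℝ → ℝ) : ℕ → ℝ
  | 0 => (g 1 + g (-1)) / 2
  | j + 1 => ((2 * (j : ℝ) + 1) / 2) * ∫ t in (-1:ℝ)..1, deriv g t * legendreP j t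

section OneVariable

open Polynomial

theorem iteratedDeriv_X_sq_sub_one_pow (m n : ℕ) (t : ℝ) :
    iteratedDeriv m (fun x : ℝ => (x ^ 2 - 1) ^ n) t =
      (derivative^[m] ((X ^ 2 - 1 : ℝ[X]) ^ n)).eval t := by
  induction m generalizing t with
  | zero => simp
  | succ m ih =>
    rw [iteratedDeriv_succ, funext ih, Function.iterate_succ_apply', Polynomial.deriv]

theorem legendreP_eq_eval (n : ℕ) (t : ℝ) : legendreP n t = (legendrePoly n).eval t := by
  simp [legendreP, legendrePoly, iteratedDeriv_X_sq_sub_one_pow]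

theorem legendreP_zero (t : ℝ) : legendreP 0 t = 1 := by
  simp [legendreP]

@[fun_prop]
theorem continuous_legendreP (n : ℕ) : Continuous (legendreP n) := by
  rw [funext (legendreP_eq_eval n)]
  exact (legendrePoly n).continuous

theorem eval_iterate_derivative_eq_zero_of_lt {m n : ℕ} (hmn : m < n) {σ : ℝ}
    (hσ : σ = -1 ∨ σ = 1) :
    (derivative^[m] ((X ^ 2 - 1 : ℝ[X]) ^ n)).eval σ = 0 := by
  obtain ⟨q, hq⟩ := pow_sub_dvd_iterate_derivative_pow (X ^ 2 - 1 : ℝ[X]) n m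
  rw [hq]
  have : n - m ≠ 0 := by omega
  rcases hσ with rfl | rfl <;> simp [this]

theorem integral_iterate_derivative_mul {m n : ℕ} (hmn : m ≤ n) (q : ℝ[X]) :
    ∫ t in (-1:ℝ)..1, (derivative^[m] ((X ^ 2 - 1 : ℝ[X]) ^ n)).eval t * q.eval t =
      (-1) ^ m * ∫ t in (-1:ℝ)..1, ((X ^ 2 - 1 : ℝ[X]) ^ n).eval t *
        (derivative^[m] q).eval t := by
  induction m generalizing q with
  | zero => simp
  | succ m ih =>
    have h := integral_deriv_mul_eq_sub (a := -1) (b := 1)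
      (fun x _ => (derivative^[m] ((X ^ 2 - 1 : ℝ[X]) ^ n)).hasDerivAt x)
      (fun x _ => q.hasDerivAt x)
      ((Polynomial.continuous _).intervalIntegrable _ _)
      ((Polynomial.continuous _).intervalIntegrable _ _)
    rw [integral_add (Continuous.intervalIntegrable (by fun_prop) _ _)
      (Continuous.intervalIntegrable (by fun_prop) _ _),
      eval_iterate_derivative_eq_zero_of_lt (by omega) (.inl rfl),
      eval_iterate_derivative_eq_zero_of_lt (by omega) (.inr rfl),
      ih (by omega), ← Function.iterate_succ_apply, ← Function.iterate_succ_apply' derivative m] at h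
    rw [Nat.succ_eq_add_one] at h
    rw [pow_succ (-1 : ℝ)]
    linarith

theorem integral_one_sub_sq_pow_succ (n : ℕ) :
    (2 * n + 3 : ℝ) * ∫ t in (-1:ℝ)..1, (1 - t ^ 2) ^ (n + 1) =
      (2 * n + 2) * ∫ t in (-1:ℝ)..1, (1 - t ^ 2) ^ n := by
  have h : ∀ x ∈ Set.uIcc (-1:ℝ) 1, HasDerivAt (fun t : ℝ => t * (1 - t ^ 2) ^ (n + 1))
      ((2 * n + 3 : ℝ) * (1 - x ^ 2) ^ (n + 1) - (2 * n + 2) * (1 - x ^ 2) ^ n) x := by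
    intro x _
    refine ((hasDerivAt_id' x).fun_mul
      ((((hasDerivAt_id' x).fun_pow 2).const_sub 1).fun_pow (n + 1))).congr_deriv ?_
    rw [Nat.add_sub_cancel]
    push_cast
    ring
  have h' := integral_eq_sub_of_hasDerivAt h (Continuous.intervalIntegrable (by fun_prop) _ _)
  rw [integral_sub (Continuous.intervalIntegrable (by fun_prop) _ _)
    (Continuous.intervalIntegrable (by fun_prop) _ _), integral_const_mul,
    integral_const_mul] at h'
  norm_num at h'
  linarith

theorem integral_one_sub_sq_pow (n : ℕ) :
    ∫ t in (-1:ℝ)..1, (1 - t ^ 2) ^ n =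
      2 ^ (2 * n + 1) * (n.factorial : ℝ) ^ 2 / (2 * n + 1).factorial := by
  induction n with
  | zero => norm_num
  | succ n ih =>
    have h := integral_one_sub_sq_pow_succ n
    rw [ih] at h
    have h3 : (2 * n + 3 : ℝ) ≠ 0 := by positivity
    rw [← mul_right_inj' h3, h, show 2 * (n + 1) + 1 = (2 * n + 1) + 1 + 1 by ring,
      Nat.factorial_succ (2 * n + 1 + 1), Nat.factorial_succ (2 * n + 1), Nat.factorial_succ n]
    push_cast
    field_simp
    ring

theorem natDegree_X_sq_sub_one_pow (n : ℕ) : ((X ^ 2 - 1 : ℝ[X]) ^ n).natDegree = 2 * n := by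
  rw [natDegree_pow, ← C_1, natDegree_X_pow_sub_C, mul_comm]

theorem coeff_X_sq_sub_one_pow (n : ℕ) : ((X ^ 2 - 1 : ℝ[X]) ^ n).coeff (2 * n) = 1 := by
  have h : ((X ^ 2 - 1 : ℝ[X]) ^ n).Monic := by
    rw [← C_1]
    exact (monic_X_pow_sub_C 1 two_ne_zero).pow n
  rw [← natDegree_X_sq_sub_one_pow n]
  exact h

theorem natDegree_legendrePoly_le (n : ℕ) : (legendrePoly n).natDegree ≤ n := by
  refine (natDegree_C_mul_le _ _).trans ((natDegree_iterate_derivative _ _).trans ?_)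
  rw [natDegree_X_sq_sub_one_pow]
  omega

theorem coeff_legendrePoly (n : ℕ) :
    (legendrePoly n).coeff n =
      (2 * n).factorial / (2 ^ n * (n.factorial : ℝ) ^ 2) := by
  have h := Nat.factorial_mul_descFactorial (show n ≤ 2 * n by omega)
  rw [show 2 * n - n = n by omega] at h
  rw [legendrePoly, coeff_C_mul, coeff_iterate_derivative, ← two_mul, coeff_X_sq_sub_one_pow, ← h]
  push_cast
  simp
  field_simp

theorem iterate_derivative_of_natDegree_le {n : ℕ} {q : ℝ[X]} (hq : q.natDegree ≤ n) :
    derivative^[n] q = C (n.factorial * q.coeff n) := by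
  ext m
  rw [coeff_iterate_derivative, coeff_C]
  split_ifs with hm
  · simp [hm, Nat.descFactorial_self]
  · rw [coeff_eq_zero_of_natDegree_lt (by omega), smul_zero]

/-- Pairing with the `n`-th Legendre polynomial reads off the coefficient of degree `n`. -/
theorem integral_legendrePoly_mul {n : ℕ} {q : ℝ[X]} (hq : q.natDegree ≤ n) :
    ∫ t in (-1:ℝ)..1, (legendrePoly n).eval t * q.eval t =
      q.coeff n * (2 ^ (n + 1) * (n.factorial : ℝ) ^ 2 / (2 * n + 1).factorial) := by
  have h := integral_iterate_derivative_mul le_rfl (n := n) q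
  have h2 : ∀ t : ℝ, ((X ^ 2 - 1 : ℝ[X]) ^ n).eval t = (-1) ^ n * (1 - t ^ 2) ^ n := by
    intro t
    rw [← mul_pow]
    simp
  simp only [iterate_derivative_of_natDegree_le hq, eval_C, h2] at h
  rw [integral_mul_const, integral_const_mul, integral_one_sub_sq_pow] at h
  simp only [legendrePoly, eval_mul, eval_C, mul_assoc]
  rw [integral_const_mul, h]
  have h3 : (-1 : ℝ) ^ n * (-1) ^ n = 1 := by rw [← mul_pow]; simp
  rw [mul_assoc ((-1 : ℝ) ^ n), ← mul_assoc ((-1 : ℝ) ^ n), h3]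
  field_simp
  ring

theorem integral_legendreP_mul_of_lt {m n : ℕ} (hmn : m < n) :
    ∫ t in (-1:ℝ)..1, legendreP n t * legendreP m t = 0 := by
  simp only [legendreP_eq_eval]
  have h := natDegree_legendrePoly_le m
  rw [integral_legendrePoly_mul (h.trans hmn.le),
    coeff_eq_zero_of_natDegree_lt (h.trans_lt hmn), zero_mul]

theorem integral_legendreP_mul_of_ne {m n : ℕ} (hmn : m ≠ n) :
    ∫ t in (-1:ℝ)..1, legendreP n t * legendreP m t = 0 := by
  rcases hmn.lt_or_gt with h | h
  · exact integral_legendreP_mul_of_lt h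
  · simpa only [mul_comm] using integral_legendreP_mul_of_lt h

theorem integral_legendreP_mul_self (n : ℕ) :
    ∫ t in (-1:ℝ)..1, legendreP n t * legendreP n t = 2 / (2 * n + 1) := by
  simp only [legendreP_eq_eval]
  rw [integral_legendrePoly_mul (natDegree_legendrePoly_le n), coeff_legendrePoly,
    Nat.factorial_succ]
  push_cast
  field_simp
  ring

/-- A function orthogonal to the first `n` Legendre polynomials is orthogonal to every
polynomial of degree less than `n`. -/
theorem integral_mul_eval_eq_zero {h : ℝ → ℝ} (hh : Continuous h) {n : ℕ}
    (horth : ∀ i < n, ∫ t in (-1:ℝ)..1, h t * legendreP i t = 0) {q : ℝ[X]}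
    (hq : ∀ i, n ≤ i → q.coeff i = 0) :
    ∫ t in (-1:ℝ)..1, h t * q.eval t = 0 := by
  induction n generalizing q with
  | zero =>
    have : q = 0 := by ext i; simp [hq i]
    simp [this]
  | succ n ih =>
    have hc : (legendrePoly n).coeff n ≠ 0 := by
      rw [coeff_legendrePoly]
      positivity
    set a := q.coeff n / (legendrePoly n).coeff n with ha
    have h1 := ih (fun i hi => horth i (by omega)) (q := q - C a * legendrePoly n) (by
      intro i hi
      rw [coeff_sub, coeff_C_mul]
      rcases hi.eq_or_lt with rfl | hi
      · rw [ha, div_mul_cancel₀ _ hc, sub_self]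
      · rw [hq i hi, coeff_eq_zero_of_natDegree_lt ((natDegree_legendrePoly_le n).trans_lt hi)]
        simp)
    have h2 := horth n (by omega)
    have h3 : ∀ t, h t * q.eval t =
        h t * (q - C a * legendrePoly n).eval t + a * (h t * legendreP n t) := by
      intro t
      simp only [eval_sub, eval_mul, eval_C, legendreP_eq_eval]
      ring
    simp only [h3]
    rw [integral_add (Continuous.intervalIntegrable (by fun_prop) _ _)
      (Continuous.intervalIntegrable (by fun_prop) _ _),
      integral_const_mul, h1, h2]
    simp

theorem hasDerivAt_Mpoly_succ (n : ℕ) (t : ℝ) :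
    HasDerivAt (Mpoly (n + 1)) (legendreP n t) t := by
  cases n with
  | zero =>
    rw [legendreP_zero]
    exact hasDerivAt_id t
  | succ n =>
    have h : Mpoly (n + 1 + 1) = fun t => (1 / (2 ^ (n + 1) * (Nat.factorial (n + 1) : ℝ))) *
        (derivative^[n] ((X ^ 2 - 1 : ℝ[X]) ^ (n + 1))).eval t := by
      ext t
      simp [Mpoly, iteratedDeriv_X_sq_sub_one_pow]
    rw [h, legendreP, iteratedDeriv_X_sq_sub_one_pow, Function.iterate_succ_apply']
    exact (Polynomial.hasDerivAt _ t).const_mul _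

theorem Mpoly_add_two_eq_zero_s13 (n : ℕ) {σ : ℝ} (hσ : σ = -1 ∨ σ = 1) : Mpoly (n + 2) σ = 0 := by
  simp [Mpoly, iteratedDeriv_X_sq_sub_one_pow,
    eval_iterate_derivative_eq_zero_of_lt (Nat.lt_succ_self n) hσ]

theorem sum_mul_Mpoly_eq {k : ℕ} (hk : 1 ≤ k) (c : ℕ → ℝ) {σ : ℝ} (hσ : σ = -1 ∨ σ = 1) :
    ∑ j ∈ Finset.range (k + 1), c j * Mpoly j σ = c 0 + c 1 * σ := by
  obtain ⟨k, rfl⟩ := Nat.exists_eq_add_of_le' hk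
  rw [Finset.sum_range_succ', Finset.sum_range_succ', Finset.sum_eq_zero]
  · simp [Mpoly, add_comm]
  · intro i _
    rw [Mpoly_add_two_eq_zero_s13 i hσ, mul_zero]

theorem exists_derivative_eq (v : ℝ[X]) {n : ℕ} (hv : v.natDegree ≤ n) :
    ∃ V : ℝ[X], derivative V = v ∧ ∀ i, n + 2 ≤ i → V.coeff i = 0 := by
  refine ⟨∑ i ∈ Finset.range (n + 1), C (v.coeff i / (i + 1)) * X ^ (i + 1), ?_, ?_⟩
  · conv_rhs => rw [v.as_sum_range_C_mul_X_pow' (Nat.lt_succ_of_le hv)]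
    rw [derivative_sum]
    refine Finset.sum_congr rfl fun i _ => ?_
    rw [derivative_C_mul_X_pow]
    congr 2
    push_cast
    field_simp
  · intro i hi
    rw [finsetSum_coeff]
    refine Finset.sum_eq_zero fun j hj => ?_
    rw [Finset.mem_range] at hj
    rw [coeff_C_mul_X_pow, if_neg (by omega)]

/-- The remainder of the one-dimensional M-type projection of degree `k` is orthogonal to all
polynomials of degree at most `k - 2`. -/
theorem integral_sub_sum_mcoeff1_mul_eval {g : ℝ → ℝ} (hg : ContDiff ℝ 1 g) {k : ℕ} (hk : 2 ≤ k)
    {v : ℝ[X]} (hv : v.natDegree ≤ k - 2) :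
    ∫ t in (-1:ℝ)..1,
      (g t - ∑ j ∈ Finset.range (k + 1), mcoeff1 g j * Mpoly j t) * v.eval t = 0 := by
  obtain ⟨V, rfl, hV⟩ := exists_derivative_eq v hv
  have hg' : Continuous (deriv g) := hg.continuous_deriv le_rfl
  have hgd : ∀ t, HasDerivAt g (deriv g t) t :=
    fun t => (hg.differentiable one_ne_zero t).hasDerivAt
  set r : ℝ → ℝ := fun t => g t - ∑ j ∈ Finset.range (k + 1), mcoeff1 g j * Mpoly j t with hr
  set r' : ℝ → ℝ := fun t =>
    deriv g t - ∑ j ∈ Finset.range k, mcoeff1 g (j + 1) * legendreP j t with hr'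
  have hrd : ∀ t, HasDerivAt r (r' t) t := by
    intro t
    refine (hgd t).sub ?_
    simp only [Finset.sum_range_succ' _ k]
    exact (HasDerivAt.fun_sum fun j _ => (hasDerivAt_Mpoly_succ j t).const_mul _).add_const
      (mcoeff1 g 0 * 1)
  have hrc : Continuous r' :=
    hg'.sub (continuous_finsetSum _ fun j _ => continuous_const.mul (continuous_legendreP j))
  have hftc : ∫ t in (-1:ℝ)..1, deriv g t = g 1 - g (-1) :=
    integral_eq_sub_of_hasDerivAt (fun t _ => hgd t) (hg'.intervalIntegrable _ _)
  have hr0 : ∀ σ : ℝ, σ = -1 ∨ σ = 1 → r σ = 0 := by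
    intro σ hσ
    simp only [hr, sum_mul_Mpoly_eq (by omega : 1 ≤ k) _ hσ, mcoeff1, legendreP_zero, mul_one,
      hftc]
    rcases hσ with rfl | rfl <;> norm_num <;> ring
  have horth : ∀ i < k, ∫ t in (-1:ℝ)..1, r' t * legendreP i t = 0 := by
    intro i hi
    simp only [hr', sub_mul, Finset.sum_mul, mul_assoc]
    rw [integral_sub (Continuous.intervalIntegrable (by fun_prop) _ _)
      (Continuous.intervalIntegrable (by fun_prop) _ _),
      integral_finsetSum fun j _ => (Continuous.intervalIntegrable (by fun_prop) _ _),
      Finset.sum_eq_single_of_mem i (Finset.mem_range.2 hi)]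
    · rw [integral_const_mul, integral_legendreP_mul_self, mcoeff1]
      field_simp
      ring
    · intro j _ hj
      rw [integral_const_mul, integral_legendreP_mul_of_ne hj.symm, mul_zero]
  have hparts := integral_mul_deriv_eq_deriv_mul (a := -1) (b := 1) (fun t _ => hrd t)
    (fun t _ => V.hasDerivAt t) (hrc.intervalIntegrable _ _)
    ((Polynomial.continuous _).intervalIntegrable _ _)
  rw [hparts, hr0 1 (.inr rfl), hr0 (-1) (.inl rfl),
    integral_mul_eval_eq_zero hrc horth fun i hi => hV i (by omega)]
  simp

end OneVariable

section TwoVariables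

variable {f : ℝ → ℝ → ℝ}

theorem hasDerivAt_left_of_differentiable {E : Type*} [NormedAddCommGroup E] [NormedSpace ℝ E]
    {F : ℝ × ℝ → E} (hF : Differentiable ℝ F) (s t : ℝ) :
    HasDerivAt (fun x => F (x, t)) (fderiv ℝ F (s, t) (1, 0)) s :=
  (hF (s, t)).hasFDerivAt.comp_hasDerivAt s ((hasDerivAt_id s).prodMk (hasDerivAt_const s t))

theorem hasDerivAt_right_of_differentiable {E : Type*} [NormedAddCommGroup E] [NormedSpace ℝ E]
    {F : ℝ × ℝ → E} (hF : Differentiable ℝ F) (s t : ℝ) :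
    HasDerivAt (fun y => F (s, y)) (fderiv ℝ F (s, t) (0, 1)) t :=
  (hF (s, t)).hasFDerivAt.comp_hasDerivAt t ((hasDerivAt_const t s).prodMk (hasDerivAt_id t))

theorem deriv_right_eq_fderiv (hf : ContDiff ℝ 2 (Function.uncurry f)) (s t : ℝ) :
    deriv (f s) t = fderiv ℝ (Function.uncurry f) (s, t) (0, 1) :=
  (hasDerivAt_right_of_differentiable (hf.differentiable two_ne_zero) s t).deriv

theorem deriv_left_eq_fderiv (hf : ContDiff ℝ 2 (Function.uncurry f)) (s t : ℝ) :
    deriv (fun x => f x t) s = fderiv ℝ (Function.uncurry f) (s, t) (1, 0) :=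
  (hasDerivAt_left_of_differentiable (hf.differentiable two_ne_zero) s t).deriv

theorem contDiff_fderiv_uncurry (hf : ContDiff ℝ 2 (Function.uncurry f)) :
    ContDiff ℝ 1 (fderiv ℝ (Function.uncurry f)) :=
  hf.fderiv_right (by norm_num)

theorem hasDerivAt_deriv_right (hf : ContDiff ℝ 2 (Function.uncurry f)) (s t : ℝ) :
    HasDerivAt (fun x => deriv (f x) t)
      (fderiv ℝ (fderiv ℝ (Function.uncurry f)) (s, t) (1, 0) (0, 1)) s := by
  simp only [deriv_right_eq_fderiv hf]
  simpa using (hasDerivAt_left_of_differentiable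
    ((contDiff_fderiv_uncurry hf).differentiable one_ne_zero) s t).clm_apply
    (hasDerivAt_const s ((0 : ℝ), (1 : ℝ)))

theorem hasDerivAt_deriv_left (hf : ContDiff ℝ 2 (Function.uncurry f)) (s t : ℝ) :
    HasDerivAt (fun y => deriv (fun x => f x y) s)
      (fderiv ℝ (fderiv ℝ (Function.uncurry f)) (s, t) (0, 1) (1, 0)) t := by
  simp only [deriv_left_eq_fderiv hf]
  simpa using (hasDerivAt_right_of_differentiable
    ((contDiff_fderiv_uncurry hf).differentiable one_ne_zero) s t).clm_apply
    (hasDerivAt_const t ((1 : ℝ), (0 : ℝ)))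

theorem continuous_mixed_deriv (hf : ContDiff ℝ 2 (Function.uncurry f)) :
    Continuous fun p : ℝ × ℝ => deriv (fun x => deriv (f x) p.2) p.1 := by
  simp only [fun p : ℝ × ℝ => (hasDerivAt_deriv_right hf p.1 p.2).deriv]
  have := (contDiff_fderiv_uncurry hf).continuous_fderiv one_ne_zero
  fun_prop

theorem hasDerivAt_deriv_left_mixed (hf : ContDiff ℝ 2 (Function.uncurry f)) (s t : ℝ) :
    HasDerivAt (fun y => deriv (fun x => f x y) s) (deriv (fun x => deriv (f x) t) s) t := by
  rw [(hasDerivAt_deriv_right hf s t).deriv,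
    (hf.contDiffAt.isSymmSndFDerivAt (by simp)).eq (1, 0) (0, 1)]
  exact hasDerivAt_deriv_left hf s t

theorem integral_mixed_deriv_right (hf : ContDiff ℝ 2 (Function.uncurry f)) (s : ℝ) :
    ∫ t in (-1:ℝ)..1, deriv (fun x => deriv (f x) t) s =
      deriv (fun x => f x 1) s - deriv (fun x => f x (-1)) s :=
  integral_eq_sub_of_hasDerivAt (fun t _ => hasDerivAt_deriv_left_mixed hf s t)
    (((continuous_mixed_deriv hf).comp (Continuous.prodMk_right s)).intervalIntegrable _ _)

theorem integral_mixed_deriv_left (hf : ContDiff ℝ 2 (Function.uncurry f)) (t : ℝ) :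
    ∫ s in (-1:ℝ)..1, deriv (fun x => deriv (f x) t) s = deriv (f 1) t - deriv (f (-1)) t :=
  integral_eq_sub_of_hasDerivAt
    (fun s _ => (hasDerivAt_deriv_right hf s t).differentiableAt.hasDerivAt)
    (((continuous_mixed_deriv hf).comp (Continuous.prodMk_left t)).intervalIntegrable _ _)

theorem contDiff_slice_right (hf : ContDiff ℝ 2 (Function.uncurry f)) (s : ℝ) :
    ContDiff ℝ 1 (f s) :=
  (hf.comp (contDiff_const.prodMk contDiff_id : ContDiff ℝ 2 fun t : ℝ => (s, t))).of_le
    (by norm_num)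

theorem contDiff_slice_left (hf : ContDiff ℝ 2 (Function.uncurry f)) (t : ℝ) :
    ContDiff ℝ 1 fun s => f s t :=
  (hf.comp (contDiff_id.prodMk contDiff_const : ContDiff ℝ 2 fun s : ℝ => (s, t))).of_le
    (by norm_num)

theorem mcoeff2_one_succ (hf : ContDiff ℝ 2 (Function.uncurry f)) (j : ℕ) :
    mcoeff2 f 1 (j + 1) = ((2 * (j : ℝ) + 1) / 4) *
      ∫ t in (-1:ℝ)..1, (deriv (f 1) t - deriv (f (-1)) t) * legendreP j t := by
  have hc := continuous_mixed_deriv hf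
  have hl := continuous_legendreP j
  have hswap : ∫ s in (-1:ℝ)..1, ∫ t in (-1:ℝ)..1,
        deriv (fun x => deriv (f x) t) s * legendreP j t =
      ∫ t in (-1:ℝ)..1, ∫ s in (-1:ℝ)..1,
        deriv (fun x => deriv (f x) t) s * legendreP j t := by
    refine MeasureTheory.intervalIntegral_intervalIntegral_swap (MeasureTheory.IntegrableOn.mono_set
      (t := Set.uIcc (-1) 1 ×ˢ Set.uIcc (-1) 1) ?_
      (Set.prod_mono Set.uIoc_subset_uIcc Set.uIoc_subset_uIcc))
    exact (hc.mul (hl.comp continuous_snd)).continuousOn.integrableOn_compact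
      (isCompact_uIcc.prod isCompact_uIcc)
  simp only [mcoeff2, legendreP_zero, mul_one]
  rw [hswap]
  simp only [integral_mul_const, integral_mixed_deriv_left hf]
  congr 1
  push_cast
  ring

theorem mcoeff2_succ_one (hf : ContDiff ℝ 2 (Function.uncurry f)) (i : ℕ) :
    mcoeff2 f (i + 1) 1 = ((2 * (i : ℝ) + 1) / 4) *
      ∫ s in (-1:ℝ)..1,
        (deriv (fun x => f x 1) s - deriv (fun x => f x (-1)) s) * legendreP i s := by
  simp only [mcoeff2, legendreP_zero, mul_one, integral_mul_const, integral_mixed_deriv_right hf]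
  congr 1
  push_cast
  ring

theorem mcoeff2_one_zero (hf : ContDiff ℝ 2 (Function.uncurry f)) :
    mcoeff2 f 1 0 = (f 1 1 - f (-1) 1 + (f 1 (-1) - f (-1) (-1))) / 4 := by
  have h : ∀ t, ∫ s in (-1:ℝ)..1, deriv (fun x => f x t) s = f 1 t - f (-1) t := fun t =>
    integral_deriv_eq_sub (fun s _ => (contDiff_slice_left hf t).differentiable one_ne_zero s)
      (((contDiff_slice_left hf t).continuous_deriv le_rfl).intervalIntegrable _ _)
  simp only [mcoeff2, legendreP_zero, mul_one]
  rw [integral_add (((contDiff_slice_left hf 1).continuous_deriv le_rfl).intervalIntegrable _ _)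
    (((contDiff_slice_left hf (-1)).continuous_deriv le_rfl).intervalIntegrable _ _), h, h]
  push_cast
  ring

theorem mcoeff2_zero_one (hf : ContDiff ℝ 2 (Function.uncurry f)) :
    mcoeff2 f 0 1 = (f 1 1 - f 1 (-1) + (f (-1) 1 - f (-1) (-1))) / 4 := by
  have h : ∀ s, ∫ t in (-1:ℝ)..1, deriv (f s) t = f s 1 - f s (-1) := fun s =>
    integral_deriv_eq_sub (fun t _ => (contDiff_slice_right hf s).differentiable one_ne_zero t)
      (((contDiff_slice_right hf s).continuous_deriv le_rfl).intervalIntegrable _ _)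
  simp only [mcoeff2, legendreP_zero, mul_one]
  rw [integral_add (((contDiff_slice_right hf 1).continuous_deriv le_rfl).intervalIntegrable _ _)
    (((contDiff_slice_right hf (-1)).continuous_deriv le_rfl).intervalIntegrable _ _), h, h]
  push_cast
  ring

theorem mcoeff2_zero_add_one_mul (hf : ContDiff ℝ 2 (Function.uncurry f)) (j : ℕ) {σ : ℝ}
    (hσ : σ = -1 ∨ σ = 1) :
    mcoeff2 f 0 j + mcoeff2 f 1 j * σ = mcoeff1 (f σ) j := by
  cases j with
  | zero =>
    rw [mcoeff2_one_zero hf]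
    rcases hσ with rfl | rfl <;> simp only [mcoeff2, mcoeff1] <;> ring
  | succ j =>
    have hi : ∀ s, IntervalIntegrable (fun t => deriv (f s) t * legendreP j t)
        MeasureTheory.volume (-1) 1 := fun s =>
      (((contDiff_slice_right hf s).continuous_deriv le_rfl).mul
        (continuous_legendreP j)).intervalIntegrable _ _
    rw [mcoeff2_one_succ hf]
    simp only [mcoeff2, mcoeff1, add_mul, sub_mul]
    rw [integral_add (hi 1) (hi (-1)), integral_sub (hi 1) (hi (-1))]
    rcases hσ with rfl | rfl <;> ring

theorem mcoeff2_add_mul_one (hf : ContDiff ℝ 2 (Function.uncurry f)) (i : ℕ) {σ : ℝ}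
    (hσ : σ = -1 ∨ σ = 1) :
    mcoeff2 f i 0 + mcoeff2 f i 1 * σ = mcoeff1 (fun s => f s σ) i := by
  cases i with
  | zero =>
    rw [mcoeff2_zero_one hf]
    rcases hσ with rfl | rfl <;> simp only [mcoeff2, mcoeff1] <;> ring
  | succ i =>
    have hi : ∀ t, IntervalIntegrable (fun s => deriv (fun x => f x t) s * legendreP i s)
        MeasureTheory.volume (-1) 1 := fun t =>
      (((contDiff_slice_left hf t).continuous_deriv le_rfl).mul
        (continuous_legendreP i)).intervalIntegrable _ _
    rw [mcoeff2_succ_one hf]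
    simp only [mcoeff2, mcoeff1, add_mul, sub_mul]
    rw [integral_add (hi 1) (hi (-1)), integral_sub (hi 1) (hi (-1))]
    rcases hσ with rfl | rfl <;> ring

theorem mproj2_left_edge (hf : ContDiff ℝ 2 (Function.uncurry f)) {k : ℕ} (hk : 1 ≤ k) {σ : ℝ}
    (hσ : σ = -1 ∨ σ = 1) (t : ℝ) :
    mproj2 f k σ t = ∑ j ∈ Finset.range (k + 1), mcoeff1 (f σ) j * Mpoly j t := by
  rw [mproj2, Finset.sum_comm]
  refine Finset.sum_congr rfl fun j _ => ?_
  rw [← Finset.sum_mul, sum_mul_Mpoly_eq hk (fun i => mcoeff2 f i j) hσ,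
    mcoeff2_zero_add_one_mul hf j hσ]

theorem mproj2_right_edge (hf : ContDiff ℝ 2 (Function.uncurry f)) {k : ℕ} (hk : 1 ≤ k) {σ : ℝ}
    (hσ : σ = -1 ∨ σ = 1) (s : ℝ) :
    mproj2 f k s σ = ∑ i ∈ Finset.range (k + 1), mcoeff1 (fun x => f x σ) i * Mpoly i s := by
  refine Finset.sum_congr rfl fun i _ => ?_
  simp only [mul_right_comm _ (Mpoly i s)]
  rw [← Finset.sum_mul, sum_mul_Mpoly_eq hk (mcoeff2 f i) hσ, mcoeff2_add_mul_one hf i hσ]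

end TwoVariables

/-- Let `k ≥ 2` and let `f` be smooth on `[−1,1]²`. Then on each edge of
the square the `Q^k` M-type projection remainder is orthogonal to all polynomials of
degree at most `k−2`. -/
theorem mproj2_remainder_orthogonal_on_edges (k : ℕ) (hk : 2 ≤ k) (f : ℝ → ℝ → ℝ)
    (hf : ContDiff ℝ (⊤ : ℕ∞) (Function.uncurry f))
    (v : Polynomial ℝ) (hv : v.degree ≤ ((k - 2 : ℕ) : WithBot ℕ))
    (σ : ℝ) (hσ : σ = -1 ∨ σ = 1) :
    (∫ t in (-1:ℝ)..1, (f σ t - mproj2 f k σ t) * v.eval t = 0) ∧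
    (∫ s in (-1:ℝ)..1, (f s σ - mproj2 f k s σ) * v.eval s = 0) := by
  have hf2 : ContDiff ℝ 2 (Function.uncurry f) := hf.of_le (by norm_cast)
  have hv' : v.natDegree ≤ k - 2 := Polynomial.natDegree_le_of_degree_le hv
  have hk1 : 1 ≤ k := by omega
  constructor
  · simp only [mproj2_left_edge hf2 hk1 hσ]
    exact integral_sub_sum_mcoeff1_mul_eval (contDiff_slice_right hf2 σ) hk hv'
  · simp only [mproj2_right_edge hf2 hk1 hσ]
    exact integral_sub_sum_mcoeff1_mul_eval (contDiff_slice_left hf2 σ) hk hv'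
end
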